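/- For d ≥ 2, the only point-map g : N^0(ℝ^d) → ℝ^d that is continuous on all of N^0 with respect to the vague topology is the point-map of the identity point-shift, i.e. the map with g(φ) = 0 for every φ ∈ N^0. -/

import Mathlib

open MeasureTheory Topology Filter
open scoped ENNReal NNReal

noncomputable section

/-- Euclidean space `ℝ^d`. -/
abbrev Rd (d : ℕ) := EuclideanSpace ℝ (Fin d)

/-- A counting measure on `ℝ^d`: a locally finite, `ℕ∞`-valued Borel measure. -/
def IsCounting {d : ℕ} (μ : MeasureTheory.Measure (Rd d)) : Prop :=
  MeasureTheory.IsLocallyFiniteMeasure μ ∧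
    ∀ s : Set (Rd d), MeasurableSet s → ∃ n : ℕ∞, μ s = n

/-- The space `N = N(ℝ^d)` of counting measures on `ℝ^d`. -/
def CM (d : ℕ) : Type := {μ : MeasureTheory.Measure (Rd d) // IsCounting μ}

theorem isCounting_map_sub {d : ℕ} (t : Rd d) (μ : MeasureTheory.Measure (Rd d))
    (h : IsCounting μ) : IsCounting (Measure.map (fun x => x - t) μ) := by
  have hmeas : Measurable (fun x : Rd d => x - t) := measurable_id.sub_const t
  obtain ⟨hlf, hcount⟩ := h
  constructor
  · constructor
    intro x
    obtain ⟨U, hxU, hUopen, hU⟩ := μ.exists_isOpen_measure_lt_top (x + t)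
    have hcont : Continuous (fun y : Rd d => y + t) := continuous_id.add continuous_const
    refine ⟨(fun y : Rd d => y + t) ⁻¹' U, ?_, ?_⟩
    · exact (hUopen.preimage hcont).mem_nhds (by simpa using hxU)
    · rw [Measure.map_apply hmeas (hUopen.preimage hcont).measurableSet]
      have hset : (fun x : Rd d => x - t) ⁻¹' ((fun y : Rd d => y + t) ⁻¹' U) = U := by
        ext y; simp
      rw [hset]; exact hU
  · intro s hs
    rw [Measure.map_apply hmeas hs]
    exact hcount _ (hmeas hs)

/-- The shift `θ_t` on counting measures: `(θ_t φ)(B) = φ(B + t)`. -/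
def CM.shift {d : ℕ} (t : Rd d) (φ : CM d) : CM d :=
  ⟨Measure.map (fun x => x - t) φ.1, isCounting_map_sub t φ.1 φ.2⟩

theorem CM.shift_singleton {d : ℕ} (t x : Rd d) (φ : CM d) :
    (CM.shift t φ).1 {x} = φ.1 {x + t} := by
  show Measure.map (fun y : Rd d => y - t) φ.1 {x} = φ.1 {x + t}
  have hm : Measurable (fun y : Rd d => y - t) := measurable_id.sub_const t
  rw [Measure.map_apply hm (measurableSet_singleton x)]
  congr 1
  ext y
  simp [sub_eq_iff_eq_add]

/-- The vague topology on `N(ℝ^d)`: the topology induced by the maps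
`φ ↦ ∫ f dφ`, for `f` continuous with compact support. -/
instance (d : ℕ) : TopologicalSpace (CM d) :=
  TopologicalSpace.induced
    (fun φ : CM d => fun f : {f : Rd d → ℝ // Continuous f ∧ HasCompactSupport f} =>
      ∫ x, f.1 x ∂φ.1)
    inferInstance

instance (d : ℕ) : MeasurableSpace (CM d) := borel (CM d)
instance (d : ℕ) : BorelSpace (CM d) := ⟨rfl⟩

/-- The space `N^0` of counting measures having a point at the origin. -/
def CM0 (d : ℕ) : Type := {φ : CM d // φ.1 {0} ≠ 0}

instance (d : ℕ) : TopologicalSpace (CM0 d) := instTopologicalSpaceSubtype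
instance (d : ℕ) : MeasurableSpace (CM0 d) := borel (CM0 d)
instance (d : ℕ) : BorelSpace (CM0 d) := ⟨rfl⟩

/-- A point-map: a measurable map `g : N^0 → ℝ^d` with `g(φ) ∈ φ`. -/
structure PointMap (d : ℕ) where
  g : CM0 d → Rd d
  measurable_g : Measurable g
  mem_g : ∀ φ : CM0 d, φ.1.1 {g φ} ≠ 0

/-- `θ_g : N^0 → N^0`, `φ ↦ θ_{g(φ)} φ`. -/
def PointMap.theta {d : ℕ} (G : PointMap d) (φ : CM0 d) : CM0 d :=
  ⟨CM.shift (G.g φ) φ.1, by rw [CM.shift_singleton, zero_add]; exact G.mem_g φ⟩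

/-- The iterated point-map together with the proof that `g^n(φ) ∈ φ`:
`g^0(φ) = 0` and `g^{n+1}(φ) = g^n(φ) + g(θ_{g^n(φ)} φ)`. -/
def PointMap.gIterAux {d : ℕ} (G : PointMap d) :
    (n : ℕ) → (φ : CM0 d) → {t : Rd d // φ.1.1 {t} ≠ 0}
  | 0, φ => ⟨0, φ.2⟩
  | n+1, φ =>
      let p := G.gIterAux n φ
      let ψ : CM0 d := ⟨CM.shift p.1 φ.1, by rw [CM.shift_singleton, zero_add]; exact p.2⟩
      ⟨p.1 + G.g ψ, by
        have h2 : (CM.shift p.1 φ.1).1 {G.g ψ} ≠ 0 := G.mem_g ψ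
        rw [CM.shift_singleton] at h2
        rw [add_comm p.1 (G.g ψ)]
        exact h2⟩

/-- The iterated point-map `g^n`. -/
def PointMap.gIter {d : ℕ} (G : PointMap d) (n : ℕ) (φ : CM0 d) : Rd d :=
  (G.gIterAux n φ).1

/-- `θ_{g^n} : N^0 → N^0`, `φ ↦ θ_{g^n(φ)} φ`. -/
def PointMap.thetaIter {d : ℕ} (G : PointMap d) (n : ℕ) (φ : CM0 d) : CM0 d :=
  ⟨CM.shift (G.gIter n φ) φ.1, by
    rw [CM.shift_singleton, zero_add]; exact (G.gIterAux n φ).2⟩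

/-- The (everywhere-defined extension of the) point-shift `f = f_g` associated with `g`:
`f_φ(x) = g(θ_x φ) + x` on the points `x ∈ φ`, and the identity elsewhere. -/
def PointMap.fTotal {d : ℕ} (G : PointMap d) (φ : CM d) (x : Rd d) : Rd d :=
  if h : φ.1 {x} ≠ 0 then
    G.g ⟨CM.shift x φ, by rw [CM.shift_singleton, zero_add]; exact h⟩ + x
  else x

end
noncomputable section
open MeasureTheory Topology Filter
open scoped ENNReal

theorem exists_ball_measure_eq_zero {d : ℕ} {μ : Measure (Rd d)} (h : IsCounting μ)
    {p : Rd d} (hp : μ {p} = 0) : ∃ r > 0, μ (Metric.ball p r) = 0 := by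
  obtain ⟨hlf, hcount⟩ := h
  obtain ⟨V, hpV, hV, hVlt⟩ := Set.exists_isOpen_lt_of_lt {p} (1 : ℝ≥0∞) (μ := μ)
    (by rw [hp]; exact zero_lt_one)
  obtain ⟨r, hr, hrV⟩ := Metric.isOpen_iff.1 hV p (hpV rfl)
  refine ⟨r, hr, ?_⟩
  obtain ⟨n, hn⟩ := hcount _ (Metric.isOpen_ball (x := p) (ε := r)).measurableSet
  have hlt : μ (Metric.ball p r) < 1 := (measure_mono hrV).trans_lt hVlt
  rw [hn] at hlt ⊢
  have : n < 1 := by exact_mod_cast hlt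
  simp [Order.lt_one_iff.1 this]

theorem IsCounting.restrict {d : ℕ} {μ : Measure (Rd d)} (h : IsCounting μ)
    {s : Set (Rd d)} (hs : MeasurableSet s) : IsCounting (μ.restrict s) := by
  obtain ⟨hlf, hcount⟩ := h
  refine ⟨inferInstance, fun t ht => ?_⟩
  rw [Measure.restrict_apply ht]
  exact hcount _ (ht.inter hs)

theorem IsCounting.add_smul_dirac {d : ℕ} {μ : Measure (Rd d)} (h : IsCounting μ)
    (m : ℕ) (p : Rd d) : IsCounting (μ + (m : ℝ≥0∞) • Measure.dirac p) := by
  obtain ⟨hlf, hcount⟩ := h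
  refine ⟨⟨fun x => ?_⟩, fun s hs => ?_⟩
  · obtain ⟨U, hxU, hU, hUfin⟩ := μ.exists_isOpen_measure_lt_top x
    refine ⟨U, hU.mem_nhds hxU, ?_⟩
    simp only [Measure.add_apply, Measure.smul_apply, smul_eq_mul]
    exact ENNReal.add_lt_top.2
      ⟨hUfin, ENNReal.mul_lt_top (ENNReal.natCast_lt_top m) (measure_lt_top _ _)⟩
  · obtain ⟨n, hn⟩ := hcount s hs
    by_cases hp : p ∈ s
    · exact ⟨n + m, by simp [hn, hp, hs]⟩
    · exact ⟨n, by simp [hn, hp, hs]⟩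

/-- The counting measure `μ` with `m` further points at `p`. -/
def CM0.addPoint {d : ℕ} (μ : CM0 d) (m : ℕ) (p : Rd d) : CM0 d :=
  ⟨⟨μ.1.1 + (m : ℝ≥0∞) • Measure.dirac p, μ.1.2.add_smul_dirac m p⟩, fun h =>
    μ.2 (by
      simp only [Measure.add_apply, add_eq_zero] at h
      exact h.1)⟩

theorem CM0.tendsto_iff {d : ℕ} {ι : Type*} {l : Filter ι} {F : ι → CM0 d} {φ : CM0 d} :
    Tendsto F l (𝓝 φ) ↔ ∀ f : Rd d → ℝ, Continuous f → HasCompactSupport f →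
      Tendsto (fun i => ∫ x, f x ∂(F i).1.1) l (𝓝 (∫ x, f x ∂φ.1.1)) := by
  have h1 : IsInducing (Subtype.val : CM0 d → CM d) := ⟨rfl⟩
  have h2 : IsInducing (fun φ : CM d =>
      fun f : {f : Rd d → ℝ // Continuous f ∧ HasCompactSupport f} => ∫ x, f.1 x ∂φ.1) := ⟨rfl⟩
  refine h1.tendsto_nhds_iff.trans (h2.tendsto_nhds_iff.trans (tendsto_pi_nhds.trans ?_))
  exact ⟨fun h f hf hf' => h ⟨f, hf, hf'⟩, fun h f => h f.1 f.2.1 f.2.2⟩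

theorem CM0.integral_addPoint {d : ℕ} (μ : CM0 d) (m : ℕ) (p : Rd d) {f : Rd d → ℝ}
    (hf : Continuous f) (hf' : HasCompactSupport f) :
    ∫ x, f x ∂(μ.addPoint m p).1.1 = ∫ x, f x ∂μ.1.1 + m * f p := by
  have := μ.1.2.1
  have hi : Integrable f (Measure.dirac p) := hf.integrable_of_hasCompactSupport hf'
  change ∫ x, f x ∂(μ.1.1 + (m : ℝ≥0∞) • Measure.dirac p) = _
  rw [integral_add_measure (hf.integrable_of_hasCompactSupport hf')
    (hi.smul_measure (ENNReal.natCast_ne_top m)), integral_smul_measure, integral_dirac]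
  simp

theorem CM0.continuous_addPoint {d : ℕ} (μ : CM0 d) (m : ℕ) :
    Continuous (μ.addPoint m) := by
  refine continuous_iff_continuousAt.2 fun p => CM0.tendsto_iff.2 fun f hf hf' => ?_
  simp only [CM0.integral_addPoint μ m _ hf hf']
  exact (continuous_const.add (continuous_const.mul hf)).tendsto p

theorem CM0.tendsto_addPoint_cocompact {d : ℕ} (μ : CM0 d) (m : ℕ) :
    Tendsto (μ.addPoint m) (cocompact (Rd d)) (𝓝 μ) := by
  refine CM0.tendsto_iff.2 fun f hf hf' => ?_
  simp only [CM0.integral_addPoint μ m _ hf hf']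
  simpa using (tendsto_const_nhds (x := ∫ x, f x ∂μ.1.1)).add
    (hf'.is_zero_at_infty.const_mul (m : ℝ))

/-- Through any non-atom `y` of a counting measure passes a line free of atoms. -/
theorem exists_line_avoiding_atoms {d : ℕ} (hd : 2 ≤ d) {μ : Measure (Rd d)}
    (h : IsCounting μ) {y : Rd d} (hy : μ {y} = 0) :
    ∃ u : Rd d, u ≠ 0 ∧ ∀ t : ℝ, μ {y + t • u} = 0 := by
  have := h.1
  have hcount : {x | 0 < μ {x}}.Countable :=
    Measure.countable_meas_pos_of_disjoint_iUnion (As := fun x : Rd d => ({x} : Set (Rd d)))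
      (fun x => measurableSet_singleton x)
      (fun a b hab => by simpa [Function.onFun] using hab)
  let i : Fin d := ⟨0, by omega⟩
  let j : Fin d := ⟨1, by omega⟩
  have hij : i ≠ j := by simp [i, j]
  obtain ⟨s, hs⟩ : ∃ s : ℝ, s ∉ (fun z : Rd d => (z - y) j / (z - y) i) '' {x | 0 < μ {x}} := by
    by_contra! hall
    exact Cardinal.not_countable_real
      ((hcount.image _).mono fun s _ => hall s)
  let u : Rd d := EuclideanSpace.single i 1 + s • EuclideanSpace.single j 1
  have hui : u i = 1 := by simp [u, hij]
  have huj : u j = s := by simp [u, hij.symm]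
  refine ⟨u, fun h0 => by simp [h0] at hui, fun t => ?_⟩
  rcases eq_or_ne t 0 with rfl | ht
  · simpa using hy
  · by_contra hne
    refine hs ⟨y + t • u, pos_iff_ne_zero.2 hne, ?_⟩
    simp [hui, huj, ht]

/-- If a continuous point-map selects the added point, it keeps selecting it while that point
moves along a curve free of other atoms. -/
theorem PointMap.g_addPoint_eq_of_continuous {d : ℕ} (G : PointMap d) (hcont : Continuous G.g)
    (μ : CM0 d) (m : ℕ) {γ : ℝ → Rd d} (hγ : Continuous γ) (hatom : ∀ t, μ.1.1 {γ t} = 0)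
    {t₀ : ℝ} (h₀ : G.g (μ.addPoint m (γ t₀)) = γ t₀) (t : ℝ) :
    G.g (μ.addPoint m (γ t)) = γ t := by
  have hF : Continuous fun t => G.g (μ.addPoint m (γ t)) :=
    hcont.comp ((μ.continuous_addPoint m).comp hγ)
  have hclopen : IsClopen {t | G.g (μ.addPoint m (γ t)) = γ t} := by
    refine ⟨isClosed_eq hF hγ, isOpen_iff_mem_nhds.2 fun t ht => ?_⟩
    obtain ⟨r, hr, hball⟩ := exists_ball_measure_eq_zero μ.1.2 (hatom t)
    have hmem : ∀ᶠ s in 𝓝 t, G.g (μ.addPoint m (γ s)) ∈ Metric.ball (γ t) r :=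
      hF.continuousAt.eventually_mem (Metric.isOpen_ball.mem_nhds (by
        rw [show G.g _ = γ t from ht]
        exact Metric.mem_ball_self hr))
    filter_upwards [hmem] with s hs
    by_contra hne
    apply G.mem_g (μ.addPoint m (γ s))
    change (μ.1.1 + (m : ℝ≥0∞) • Measure.dirac (γ s)) {G.g (μ.addPoint m (γ s))} = 0
    have hne' : γ s ≠ G.g (μ.addPoint m (γ s)) := fun h => hne h.symm
    have hz := measure_mono_null (Set.singleton_subset_iff.2 hs) hball
    simp [hz, hne']
  have := hclopen.eq_univ ⟨t₀, h₀⟩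
  exact Set.eq_univ_iff_forall.1 this t

/-- For `d ≥ 2`, the only point-map `g : N^0(ℝ^d) → ℝ^d` which is
continuous on all of `N^0` (w.r.t. the vague topology) is the point-map of the identity
point-shift, i.e. the map sending every `φ ∈ N^0` to the origin. -/
theorem continuous_pointMap_is_identity {d : ℕ} (hd : 2 ≤ d) (G : PointMap d)
    (hcont : Continuous G.g) : ∀ φ : CM0 d, G.g φ = 0 := by
  intro φ
  by_contra hy
  set y := G.g φ with hydef
  have := φ.1.2.1
  have hms : MeasurableSet ({y} : Set (Rd d)) := measurableSet_singleton y
  obtain ⟨m, hm⟩ : ∃ m : ℕ, φ.1.1 {y} = m := by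
    obtain ⟨n, hn⟩ := φ.1.2.2 {y} hms
    have hfin : φ.1.1 {y} < ∞ := isCompact_singleton.measure_lt_top
    rw [hn] at hfin
    obtain ⟨m, rfl⟩ := ENat.ne_top_iff_exists.1 (show n ≠ ⊤ by rintro rfl; simp at hfin)
    exact ⟨m, by simpa using hn⟩
  let μ : CM0 d := ⟨⟨φ.1.1.restrict {y}ᶜ, φ.1.2.restrict hms.compl⟩, by
    change φ.1.1.restrict {y}ᶜ {0} ≠ 0
    rw [Measure.restrict_apply (measurableSet_singleton 0),
      Set.inter_eq_left.2 (by simpa using hy)]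
    exact φ.2⟩
  have hμy : μ.1.1 {y} = 0 := by
    change φ.1.1.restrict {y}ᶜ {y} = 0
    simp [Measure.restrict_apply hms]
  have hφ : μ.addPoint m y = φ := by
    refine Subtype.ext (Subtype.ext ?_)
    change φ.1.1.restrict {y}ᶜ + (m : ℝ≥0∞) • Measure.dirac y = φ.1.1
    rw [← hm, ← Measure.restrict_singleton, Measure.restrict_compl_add_restrict hms]
  obtain ⟨u, hu, hline⟩ := exists_line_avoiding_atoms hd μ.1.2 hμy
  have hg := G.g_addPoint_eq_of_continuous hcont μ m
    (γ := fun t => y + t • u) (by fun_prop) hline (t₀ := 0)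
    (by simp only [zero_smul, add_zero, hφ]; exact hydef.symm)
  have hinf : Tendsto (fun t : ℝ => y + t • u) atTop (cocompact (Rd d)) := by
    have h1 : Tendsto (fun t : ℝ => t • u) atTop (cocompact (Rd d)) :=
      ((isClosedEmbedding_smul_left hu).tendsto_cocompact).mono_left atTop_le_cocompact
    exact (Homeomorph.addLeft y).isClosedEmbedding.tendsto_cocompact.comp h1
  have hlim := (hcont.tendsto μ).comp ((μ.tendsto_addPoint_cocompact m).comp hinf)
  have hlim' : Tendsto (fun t : ℝ => y + t • u) atTop (𝓝 (G.g μ)) :=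
    hlim.congr hg
  exact (hinf.not_tendsto (disjoint_nhds_cocompact _).symm) hlim'

end
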